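/- Glaisher's determinant expression for the Cauchy numbers: let c_n denote the Cauchy numbers, defined by t/log(1+t) = Σ_{n≥0} c_n t^n/n!; equivalently, c_n/n! is the n-th coefficient of the multiplicative inverse in ℚ[[t]] of the power series log(1+t)/t = Σ_{n≥0} (−1)^n t^n/(n+1). Then for every n ≥ 1, c_n = n! · det K, where K is the n×n matrix whose (i,j) entry (1 ≤ i, j ≤ n) is 1/(i−j+2) if i ≥ j, is 1 if j = i+1, and is 0 if j > i+1. -/

import Mathlib

/-- The coefficients of the inverse of a power series with constant term `1` are, up to sign,
determinants of Toeplitz–Hessenberg matrices. -/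
theorem PowerSeries.coeff_eq_det_of_mul_eq_one {R : Type*} [CommRing R] {f g : PowerSeries R}
    (hf : PowerSeries.coeff 0 f = 1) (hfg : f * g = 1) (n : ℕ) :
    PowerSeries.coeff n g = (-1) ^ n * Matrix.det (Matrix.of fun i j : Fin n =>
      if (j : ℕ) ≤ (i : ℕ) + 1 then PowerSeries.coeff ((i : ℕ) + 1 - (j : ℕ)) f else 0) := by
  set L : Matrix (Fin (n + 1)) (Fin (n + 1)) R := Matrix.of fun i j =>
    if (j : ℕ) ≤ (i : ℕ) then PowerSeries.coeff ((i : ℕ) - (j : ℕ)) f else 0 with hL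
  have hdet : L.det = 1 := by
    rw [Matrix.det_of_isLowerTriangular L fun i j hij => ?_]
    · simp [hL, -PowerSeries.coeff_zero_eq_constantCoeff, hf]
    · exact if_neg (not_le.mpr hij)
  have hmul : L.mulVec (fun j => PowerSeries.coeff (j : ℕ) g) = Pi.single 0 1 := by
    ext i
    have hi := congrArg (PowerSeries.coeff (i : ℕ)) hfg
    rw [mul_comm, PowerSeries.coeff_mul, Finset.Nat.sum_antidiagonal_eq_sum_range_succ
      fun p q => PowerSeries.coeff p g * PowerSeries.coeff q f] at hi
    have hsub : Finset.range ((i : ℕ) + 1) ⊆ Finset.range (n + 1) := by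
      simpa using Nat.lt_succ_iff.mp i.isLt
    have hsum : ∑ j : Fin (n + 1), L i j * PowerSeries.coeff (j : ℕ) g =
        ∑ k ∈ Finset.range (n + 1), (if k ≤ (i : ℕ) then
          PowerSeries.coeff ((i : ℕ) - k) f else 0) * PowerSeries.coeff k g :=
      (Finset.sum_range fun k => (if k ≤ (i : ℕ) then
        PowerSeries.coeff ((i : ℕ) - k) f else 0) * PowerSeries.coeff k g).symm
    rw [Matrix.mulVec, dotProduct, hsum, ← Finset.sum_subset hsub]
    · rw [PowerSeries.coeff_one] at hi
      rw [Pi.single_apply]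
      simp only [Fin.ext_iff, Fin.val_zero]
      rw [← hi]
      refine Finset.sum_congr rfl fun k hk => ?_
      rw [if_pos (Nat.lt_succ_iff.mp (Finset.mem_range.mp hk)), mul_comm]
    · intro k _ hk
      rw [if_neg (by simpa using hk), zero_mul]
  have hadj := congrArg (fun v => L.adjugate.mulVec v (Fin.last n)) hmul
  simp only [Matrix.mulVec_mulVec, Matrix.adjugate_mul, hdet, one_smul, Matrix.one_mulVec,
    Matrix.mulVec_single_one, Matrix.col_apply, Matrix.adjugate_fin_succ_eq_det_submatrix] at hadj
  simp only [Fin.val_last, Fin.val_zero, zero_add, Fin.succAbove_last] at hadj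
  rw [hadj]
  congr 2

/-- Glaisher's determinant expression for the Cauchy numbers, defined by
`t/log(1+t) = Σ cₙ tⁿ/n!`, i.e. `cₙ/n!` is the `n`-th coefficient of the
inverse of `log(1+t)/t = Σ (-1)ⁿ tⁿ/(n+1)` in `ℚ[[t]]`. -/
theorem glaisher_cauchy_det (c : ℕ → ℚ)
    (hc : (PowerSeries.mk fun n => (-1 : ℚ) ^ n / ((n + 1 : ℕ) : ℚ))⁻¹ =
      PowerSeries.mk fun n => c n / (n.factorial : ℚ))
    (n : ℕ) (hn : 1 ≤ n) :
    c n = (n.factorial : ℚ) *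
      Matrix.det (Matrix.of fun i j : Fin n =>
        if (j : ℕ) ≤ (i : ℕ) then
          (1 : ℚ) / ((((i : ℕ) - (j : ℕ) + 2 : ℕ)) : ℚ)
        else if (j : ℕ) = (i : ℕ) + 1 then 1
        else 0) := by
  set f : PowerSeries ℚ := PowerSeries.mk fun n => (-1 : ℚ) ^ n / ((n + 1 : ℕ) : ℚ) with hf
  have hmul : f * PowerSeries.mk (fun n => c n / (n.factorial : ℚ)) = 1 := by
    rw [← hc]
    exact PowerSeries.mul_inv_cancel f
      (by simp [hf, ← PowerSeries.coeff_zero_eq_constantCoeff_apply])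
  have hneg := congrArg (PowerSeries.rescale (-1 : ℚ)) hmul
  rw [map_mul, map_one] at hneg
  have hcoeff (k : ℕ) :
      PowerSeries.coeff k (PowerSeries.rescale (-1 : ℚ) f) = 1 / ((k + 1 : ℕ) : ℚ) := by
    rw [PowerSeries.coeff_rescale, hf, PowerSeries.coeff_mk, ← mul_div_assoc, ← mul_pow]
    simp
  have key := PowerSeries.coeff_eq_det_of_mul_eq_one (by simp [hcoeff]) hneg n
  rw [PowerSeries.coeff_rescale, PowerSeries.coeff_mk] at key
  have hdiv := mul_left_cancel₀ (pow_ne_zero n (by norm_num : (-1 : ℚ) ≠ 0)) key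
  rw [div_eq_iff (by positivity), mul_comm] at hdiv
  rw [hdiv]
  congr 3
  ext i j
  rw [hcoeff]
  rcases lt_trichotomy (j : ℕ) (i + 1) with h | h | h
  · rw [if_pos h.le, if_pos (by lia), show (i : ℕ) + 1 - j + 1 = i - j + 2 by lia]
  · simp [h]
  · rw [if_neg (by lia), if_neg (by lia), if_neg (by lia)]
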